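/- arXiv:2307.10988 — 3 statements merged into one kernel-verified Lean document; each statement's English description precedes it below -/
import Mathlib

section
/- Let D_X ⊆ ℝ^d be a finite set of feature vectors partitioned into a nonempty labelled set L_X and an unlabelled set U_X, and for each x ∈ D_X let μ_x be a probability measure on ℝ (the conditional label distribution) with conditional mean m(x) := ∫ y dμ_x(y). Let l : ℝ^d × ℝ → [0,∞) be an error function and define the fill distance h := max_{x ∈ D_X} min_{x_j ∈ L_X} ‖x − x_j‖₂. Assume: (i) ∫ |y − m(x)| dμ_x(y) ≤ ε for every x ∈ D_X (labels uncertainty); (ii) |m(x) − m(x′)| ≤ λ_p ‖x − x′‖₂ for all x, x′ ∈ D_X; (iii) for every y ∈ ℝ the map x ↦ l(x,y) is λ_{lX}-Lipschitz; (iv) for every x ∈ ℝ^d the map y ↦ l(x,y) is λ_{lY}-Lipschitz and convex; (v) ∫ l(x_j, y) dμ_{x_j}(y) ≤ ε_L for every x_j ∈ L_X (maximum expected training error); and (vi) for every x ∈ D_X and every x′ ∈ D_X the functions y ↦ l(x′, y) and y ↦ |y| are integrable with respect to μ_x. Then for every x ∈ U_X one has ∫ l(x, y) dμ_x(y) ≤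 h·(λ_{lX} + λ_{lY}·λ_p) + λ_{lY}·ε + ε_L. -/
open MeasureTheory

/-- Theorem 1 of the paper: upper bound on the maximum expected prediction error on the
unlabelled set, linear in the training set fill distance. -/
theorem fill_distance_error_bound
    {d : ℕ} (DX LX UX : Finset (EuclideanSpace ℝ (Fin d)))
    (hpart : (DX : Set (EuclideanSpace ℝ (Fin d))) = ↑LX ∪ ↑UX) (hdisj : Disjoint LX UX)
    (hLXne : LX.Nonempty) (hDXne : DX.Nonempty)
    (μ : EuclideanSpace ℝ (Fin d) → Measure ℝ)
    (hprob : ∀ x, IsProbabilityMeasure (μ x))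
    (m : EuclideanSpace ℝ (Fin d) → ℝ)
    (hm : ∀ x, m x = ∫ y, y ∂(μ x))
    (l : EuclideanSpace ℝ (Fin d) → ℝ → ℝ)
    (hl_nonneg : ∀ x y, 0 ≤ l x y)
    (ε lam_p lam_lX lam_lY εL h : ℝ)
    (hh : h = DX.sup' hDXne fun x => LX.inf' hLXne fun xj => ‖x - xj‖)
    -- (i) labels uncertainty
    (h_unc : ∀ x ∈ DX, ∫ y, |y - m x| ∂(μ x) ≤ ε)
    -- (ii) Lipschitz continuity of the conditional mean
    (h_mean_lip : ∀ x ∈ DX, ∀ x' ∈ DX, |m x - m x'| ≤ lam_p * ‖x - x'‖)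
    -- (iii) Lipschitz continuity of the error in the feature variable
    (h_lipX : ∀ (y : ℝ) (x x' : EuclideanSpace ℝ (Fin d)),
      |l x y - l x' y| ≤ lam_lX * ‖x - x'‖)
    -- (iv) Lipschitz continuity and convexity of the error in the label variable
    (h_lipY : ∀ (x : EuclideanSpace ℝ (Fin d)) (y y' : ℝ),
      |l x y - l x y'| ≤ lam_lY * |y - y'|)
    (h_conv : ∀ x : EuclideanSpace ℝ (Fin d), ConvexOn ℝ Set.univ (fun y => l x y))
    -- (v) maximum expected training error
    (h_train : ∀ xj ∈ LX, ∫ y, l xj y ∂(μ xj) ≤ εL)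
    -- (vi) integrability
    (h_int : ∀ x ∈ DX, ∀ x' ∈ DX, Integrable (fun y => l x' y) (μ x))
    (h_int_abs : ∀ x ∈ DX, Integrable (fun y : ℝ => |y|) (μ x)) :
    ∀ x ∈ UX, ∫ y, l x y ∂(μ x) ≤ h * (lam_lX + lam_lY * lam_p) + lam_lY * ε + εL := by
  intro x hx
  have hDX : ∀ z, z ∈ DX ↔ z ∈ LX ∨ z ∈ UX := by
    intro z
    have := Set.ext_iff.1 hpart z
    simpa using this
  obtain ⟨xj, hxj, hmin⟩ := LX.exists_mem_eq_inf' hLXne (fun xj => ‖x - xj‖)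
  have hxD : x ∈ DX := (hDX x).2 (Or.inr hx)
  have hxjD : xj ∈ DX := (hDX xj).2 (Or.inl hxj)
  have hr : ‖x - xj‖ ≤ h := by
    rw [hh, ← hmin]
    exact Finset.le_sup' (fun x => LX.inf' hLXne fun xj => ‖x - xj‖) hxD
  have hne : x ≠ xj := by
    rintro rfl
    exact Finset.disjoint_left.1 hdisj hxj hx
  have hpos : 0 < ‖x - xj‖ := norm_pos_iff.2 (sub_ne_zero.2 hne)
  have hY : 0 ≤ lam_lY := by
    have := (abs_nonneg _).trans (h_lipY x 1 0)
    simpa using this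
  have hp : 0 ≤ lam_p :=
    nonneg_of_mul_nonneg_left ((abs_nonneg _).trans (h_mean_lip x hxD xj hxjD)) hpos
  have hX : 0 ≤ lam_lX :=
    nonneg_of_mul_nonneg_left ((abs_nonneg _).trans (h_lipX 0 x xj)) hpos
  have hid : ∀ z ∈ DX, Integrable (fun y : ℝ => y) (μ z) := fun z hz =>
    (integrable_norm_iff (f := fun y : ℝ => y) measurable_id.aestronglyMeasurable).1
      (h_int_abs z hz)
  have hcont : Continuous (fun y => l xj y) := by
    have : LipschitzWith lam_lY.toNNReal (fun y => l xj y) := by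
      refine LipschitzWith.of_dist_le_mul fun a b => ?_
      rw [Real.coe_toNNReal _ hY, Real.dist_eq, Real.dist_eq]
      exact h_lipY xj a b
    exact this.continuous
  have := hprob x
  have := hprob xj
  have hJ : l xj (m xj) ≤ εL := by
    refine le_trans ?_ (h_train xj hxj)
    rw [hm xj]
    exact (h_conv xj).map_integral_le hcont.continuousOn isClosed_univ
      (Filter.Eventually.of_forall fun _ => Set.mem_univ _) (hid xj hxjD) (h_int xj hxjD xj hxjD)
  have hI : Integrable (fun y => |y - m x|) (μ x) :=
    ((hid x hxD).sub (integrable_const (m x))).abs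
  have h1 : ∫ y, l x y ∂(μ x) ≤ l x (m x) + lam_lY * ε := by
    calc ∫ y, l x y ∂(μ x) ≤ ∫ y, (l x (m x) + lam_lY * |y - m x|) ∂(μ x) := by
          refine integral_mono (h_int x hxD x hxD)
            ((integrable_const _).add (hI.const_mul _)) fun y => ?_
          have := (le_abs_self _).trans (h_lipY x y (m x))
          simp only
          linarith
      _ = l x (m x) + lam_lY * ∫ y, |y - m x| ∂(μ x) := by
          rw [integral_add (integrable_const _) (hI.const_mul _), integral_const_mul]
          simp
      _ ≤ _ := by
          have := mul_le_mul_of_nonneg_left (h_unc x hxD) hY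
          linarith
  have h2 := (le_abs_self _).trans (h_lipX (m x) x xj)
  have h3 := (le_abs_self _).trans (h_lipY xj (m x) (m xj))
  have h4 := mul_le_mul_of_nonneg_left (h_mean_lip x hxD xj hxjD) hY
  have h5 := mul_le_mul_of_nonneg_right hr (add_nonneg hX (mul_nonneg hY hp))
  linarith
end

section
/- Let γ > 0, let x_1, …, x_b ∈ ℝ^d, let α ∈ ℝ^b, and let λ_k ≥ 0 be such that |exp(−γ s²) − exp(−γ t²)| ≤ λ_k |s − t| for all s, t ≥ 0. Define the kernel ridge regression prediction function f : ℝ^d → ℝ by f(x) := Σ_{j=1}^{b} α_j · exp(−γ‖x − x_j‖₂²). Then for all x̃, x̂ ∈ ℝ^d one has |f(x̃) − f(x̂)| ≤ ‖α‖₂ · √b · λ_k · ‖x̃ − x̂‖₂; in particular, f is Lipschitz continuous. -/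
/-- Lemma of Section 5.1 of the paper: the kernel ridge regression prediction function with
the Gaussian kernel is Lipschitz continuous. -/
theorem krr_gaussian_lipschitz
    {d b : ℕ} (γ : ℝ) (hγ : 0 < γ)
    (xs : Fin b → EuclideanSpace ℝ (Fin d))
    (α : EuclideanSpace ℝ (Fin b))
    (lam_k : ℝ) (hlam_k : 0 ≤ lam_k)
    (hlip : ∀ s t : ℝ, 0 ≤ s → 0 ≤ t →
      |Real.exp (-γ * s ^ 2) - Real.exp (-γ * t ^ 2)| ≤ lam_k * |s - t|)
    (f : EuclideanSpace ℝ (Fin d) → ℝ)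
    (hf : ∀ x, f x = ∑ j, α j * Real.exp (-γ * ‖x - xs j‖ ^ 2)) :
    ∀ xt xh : EuclideanSpace ℝ (Fin d),
      |f xt - f xh| ≤ ‖α‖ * Real.sqrt b * lam_k * ‖xt - xh‖ := by
  intro xt xh
  have h1 : ∑ j, |α j| ≤ ‖α‖ * Real.sqrt b := by
    rw [EuclideanSpace.norm_eq, ← Real.sqrt_mul (Finset.sum_nonneg fun i _ => sq_nonneg _)]
    apply Real.le_sqrt_of_sq_le
    have h := sq_sum_le_card_mul_sum_sq (s := (Finset.univ : Finset (Fin b)))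
      (f := fun j => |α j|)
    simp only [Finset.card_univ, Fintype.card_fin] at h
    simp only [Real.norm_eq_abs]
    linarith
  have h2 : ∀ j, |Real.exp (-γ * ‖xt - xs j‖ ^ 2) - Real.exp (-γ * ‖xh - xs j‖ ^ 2)|
      ≤ lam_k * ‖xt - xh‖ := by
    intro j
    refine (hlip _ _ (norm_nonneg _) (norm_nonneg _)).trans ?_
    refine mul_le_mul_of_nonneg_left ?_ hlam_k
    have h := abs_norm_sub_norm_le (xt - xs j) (xh - xs j)
    rwa [sub_sub_sub_cancel_right] at h
  rw [hf, hf, ← Finset.sum_sub_distrib]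
  calc _ ≤ ∑ j, |α j| * (lam_k * ‖xt - xh‖) := by
        refine (Finset.abs_sum_le_sum_abs _ _).trans (Finset.sum_le_sum fun j _ => ?_)
        rw [← mul_sub, abs_mul]
        exact mul_le_mul_of_nonneg_left (h2 j) (abs_nonneg _)
    _ = (∑ j, |α j|) * (lam_k * ‖xt - xh‖) := by rw [Finset.sum_mul]
    _ ≤ (‖α‖ * Real.sqrt b) * (lam_k * ‖xt - xh‖) :=
        mul_le_mul_of_nonneg_right h1 (mul_nonneg hlam_k (norm_nonneg _))
    _ = _ := by ring
end

section
/- Let γ > 0, let x_1, …, x_b ∈ ℝ^d, and let λ_k ≥ 0 be such that |exp(−γ s²) − exp(−γ t²)| ≤ λ_k |s − t| for all s, t ≥ 0. For x ∈ ℝ^d define the kernel vector k_x := (exp(−γ‖x − x_1‖₂²), …, exp(−γ‖x − x_b‖₂²)) ∈ ℝ^b. Then for all x̃, x̂ ∈ ℝ^d one has ‖k_{x̃} − k_{x̂}‖₂ ≤ √b · λ_k · ‖x̃ − x̂‖₂. -/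
/-- Key intermediate estimate in the proof of the paper's Lemma: the Gaussian kernel vector
map is Lipschitz with constant `√b · λ_k`. -/
theorem gaussian_kernel_vector_lipschitz
    {d b : ℕ} (γ : ℝ) (hγ : 0 < γ)
    (xs : Fin b → EuclideanSpace ℝ (Fin d))
    (lam_k : ℝ) (hlam_k : 0 ≤ lam_k)
    (hlip : ∀ s t : ℝ, 0 ≤ s → 0 ≤ t →
      |Real.exp (-γ * s ^ 2) - Real.exp (-γ * t ^ 2)| ≤ lam_k * |s - t|)
    (kvec : EuclideanSpace ℝ (Fin d) → EuclideanSpace ℝ (Fin b))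
    (hkvec : ∀ x j, kvec x j = Real.exp (-γ * ‖x - xs j‖ ^ 2)) :
    ∀ xt xh : EuclideanSpace ℝ (Fin d),
      ‖kvec xt - kvec xh‖ ≤ Real.sqrt b * lam_k * ‖xt - xh‖ := by
  intro xt xh
  have key : ∀ j, ‖(kvec xt - kvec xh) j‖ ^ 2 ≤ (lam_k * ‖xt - xh‖) ^ 2 := by
    intro j
    have h1 := hlip ‖xt - xs j‖ ‖xh - xs j‖ (norm_nonneg _) (norm_nonneg _)
    have h2 := abs_norm_sub_norm_le (xt - xs j) (xh - xs j)
    rw [sub_sub_sub_cancel_right] at h2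
    rw [PiLp.sub_apply, hkvec, hkvec, Real.norm_eq_abs]
    exact pow_le_pow_left₀ (abs_nonneg _)
      (h1.trans (mul_le_mul_of_nonneg_left h2 hlam_k)) 2
  have hnn : 0 ≤ lam_k * ‖xt - xh‖ := mul_nonneg hlam_k (norm_nonneg _)
  rw [EuclideanSpace.norm_eq, mul_assoc]
  apply Real.sqrt_le_iff.mpr
  refine ⟨mul_nonneg (Real.sqrt_nonneg _) hnn, ?_⟩
  rw [mul_pow (Real.sqrt b), Real.sq_sqrt (Nat.cast_nonneg b)]
  calc _ ≤ ∑ _j : Fin b, (lam_k * ‖xt - xh‖) ^ 2 := Finset.sum_le_sum fun j _ => key j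
    _ = _ := by simp
end
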